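/- Let h : S¹ → S¹ be an orientation-preserving homeomorphism which is absolutely continuous with h'(θ) > 0 for almost every θ and E(log h') < ∞ (equivalently, by Shen's characterization, h is a Weil–Petersson class quasisymmetric homeomorphism). Then for every ε ∈ (0, 1/2), both h and h⁻¹ belong to the Sobolev space H^{3/2−ε}(S¹): each is absolutely continuous, its derivative lies in L²(0,2π), and its derivative has finite Ḣ^{1/2−ε}(S¹) seminorm (Gay-Balmaz–Marsden–Ratiu). -/

import Mathlib

/-!
STATEMENT 10 (Gay-Balmaz–Marsden–Ratiu): if `h` is a Weil–Petersson class quasisymmetric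
homeomorphism of the circle (absolutely continuous with `h' > 0` a.e. and `E(log h') < ∞`),
then for every `ε ∈ (0, 1/2)` both `h` and `h⁻¹` belong to `H^{3/2−ε}(S¹)`: each is
absolutely continuous, with derivative in `L²(0, 2π)` and of finite `Ḣ^{1/2−ε}(S¹)`
seminorm.
-/

open MeasureTheory Metric Real

/-- Douglas energy of a `2π`-periodic function of the angle: the `Ḣ^{1/2}(S¹)` seminorm
`∬ |u(θ)−u(σ)|²/|e^{iθ}−e^{iσ}|² dθ dσ` over one period in each variable. -/
noncomputable def douglasEnergyP (u : ℝ → ℂ) : ENNReal :=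
  ∫⁻ θ in Set.Ioc 0 (2 * π), ∫⁻ σ in Set.Ioc 0 (2 * π),
    ENNReal.ofReal
      (‖u θ - u σ‖ ^ 2 / ‖Complex.exp (θ * Complex.I) - Complex.exp (σ * Complex.I)‖ ^ 2)

/-- The homogeneous `Ḣ^s(S¹)` seminorm (squared) of a `2π`-periodic function of the angle. -/
noncomputable def sobolevSeminorm (s : ℝ) (u : ℝ → ℂ) : ENNReal :=
  ∫⁻ θ in Set.Ioc 0 (2 * π), ∫⁻ σ in Set.Ioc 0 (2 * π),
    ENNReal.ofReal
      (‖u θ - u σ‖ ^ 2 /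
        ‖Complex.exp (θ * Complex.I) - Complex.exp (σ * Complex.I)‖ ^ (1 + 2 * s))

/-- The chordal distance between the points of the unit circle at angles `x` and `y`. -/
noncomputable def chord (x y : ℝ) : ℝ :=
  ‖Complex.exp (x * Complex.I) - Complex.exp (y * Complex.I)‖

lemma chord_nonneg (x y : ℝ) : 0 ≤ chord x y := norm_nonneg _

lemma chord_eq (x y : ℝ) : chord x y = |2 * Real.sin ((x - y) / 2)| := by
  have h : Complex.exp (x * Complex.I) - Complex.exp (y * Complex.I)
      = Complex.exp (y * Complex.I) * (Complex.exp (Complex.I * ((x - y : ℝ) : ℂ)) - 1) := by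
    rw [mul_sub, ← Complex.exp_add, mul_one]
    congr 2
    push_cast
    ring
  rw [chord, h, norm_mul, Complex.norm_exp_ofReal_mul_I, one_mul,
    Complex.norm_exp_I_mul_ofReal_sub_one, Real.norm_eq_abs]

lemma chord_le_abs_sub (x y : ℝ) : chord x y ≤ |x - y| := by
  rw [chord_eq, abs_mul, abs_two]
  have := Real.abs_sin_le_abs (x := (x - y) / 2)
  rw [abs_div, abs_two] at this
  linarith

lemma chord_add_int_mul (x y : ℝ) (k : ℤ) : chord x (y + k * (2 * π)) = chord x y := by
  have : Complex.exp (((y + k * (2 * π) : ℝ) : ℂ) * Complex.I) = Complex.exp (y * Complex.I) := by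
    rw [Complex.exp_eq_exp_iff_exists_int]
    exact ⟨k, by push_cast; ring⟩
  rw [chord, chord, this]

lemma chord_comm (x y : ℝ) : chord x y = chord y x := norm_sub_rev _ _

lemma chord_add_two_pi_right (x y : ℝ) : chord x (y + 2 * π) = chord x y := by
  simpa using chord_add_int_mul x y 1

lemma chord_add_two_pi_left (x y : ℝ) : chord (x + 2 * π) y = chord x y := by
  rw [chord_comm, chord_add_two_pi_right, chord_comm]

lemma measurable_chord : Measurable fun p : ℝ × ℝ => chord p.1 p.2 := by
  unfold chord
  fun_prop

/-- The arc between two points of the circle is at most `π / 2` times the chord. -/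
lemma exists_int_abs_sub_le_chord (x y : ℝ) :
    ∃ k : ℤ, |x - (y + k * (2 * π))| ≤ π ∧ |x - (y + k * (2 * π))| ≤ π / 2 * chord x y := by
  refine ⟨round ((x - y) / (2 * π)), ?_⟩
  have hπ := Real.pi_pos
  set k := round ((x - y) / (2 * π)) with hk
  have h1 : |x - (y + k * (2 * π))| ≤ π := by
    have h := abs_sub_round ((x - y) / (2 * π))
    have h2 : x - (y + k * (2 * π)) = ((x - y) / (2 * π) - k) * (2 * π) := by
      field_simp
      ring
    rw [h2, abs_mul, abs_of_pos (by positivity : 0 < 2 * π)]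
    nlinarith
  refine ⟨h1, ?_⟩
  rw [← chord_add_int_mul x y k, chord_eq]
  set z := x - (y + k * (2 * π))
  have h3 : |z / 2| ≤ π / 2 := by
    rw [abs_div, abs_two]
    linarith
  have h4 := Real.mul_abs_le_abs_sin h3
  rw [abs_mul, abs_two]
  rw [abs_div, abs_two] at h4
  have h5 : |z| = π * (2 / π * (|z| / 2)) := by
    field_simp
  nlinarith

lemma exists_int_eq_of_chord_eq_zero {x y : ℝ} (h : chord x y = 0) :
    ∃ k : ℤ, x = y + k * (2 * π) := by
  obtain ⟨k, -, hk⟩ := exists_int_abs_sub_le_chord x y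
  rw [h, mul_zero] at hk
  exact ⟨k, by linarith [abs_nonpos_iff.1 hk]⟩

/-- The integral of a periodic function over a period does not depend on the period. -/
lemma setLIntegral_Ioc_eq_of_periodic {f : ℝ → ENNReal} (hf : Function.Periodic f (2 * π))
    (a : ℝ) : ∫⁻ x in Set.Ioc a (a + 2 * π), f x = ∫⁻ x in Set.Ioc 0 (2 * π), f x := by
  have h := (isAddFundamentalDomain_Ioc Real.two_pi_pos a).setLIntegral_eq
    (isAddFundamentalDomain_Ioc Real.two_pi_pos 0) f hf.map_vadd_zmultiples
  simpa using h

/-- Pointwise interpolation bound behind the Sobolev estimates. -/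
lemma weighted_exp_sub_sq_div_le {ε : ℝ} (hε : 0 < ε) (hε1 : ε < 1) (a b d w : ℝ) (hd : 0 ≤ d)
    (hw : 0 ≤ w) :
    w * (Real.exp a - Real.exp b) ^ 2 / d ^ (2 - 2 * ε) ≤
      (a - b) ^ 2 / d ^ 2 + (w * (Real.exp a + Real.exp b) ^ 2) ^ (1 / ε) := by
  have hS : 0 < Real.exp a + Real.exp b := by positivity
  have hab : ∀ a b : ℝ, Real.exp a - Real.exp b ≤ |a - b| * (Real.exp a + Real.exp b) := by
    intro a b
    have h1 : (a - b) ≥ 1 - Real.exp (b - a) := by linarith [Real.add_one_le_exp (b - a)]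
    have h2 : Real.exp b = Real.exp a * Real.exp (b - a) := by
      rw [← Real.exp_add]; congr 1; ring
    have h3 := le_abs_self (a - b)
    have : Real.exp a - Real.exp b ≤ Real.exp a * |a - b| := by
      rw [h2]; nlinarith [Real.exp_pos a]
    nlinarith [Real.exp_pos b, abs_nonneg (a - b), mul_nonneg (Real.exp_pos b).le (abs_nonneg (a - b))]
  have hD1 : |Real.exp a - Real.exp b| ≤ |a - b| * (Real.exp a + Real.exp b) := by
    rw [abs_le']
    refine ⟨hab a b, ?_⟩
    have := hab b a
    rw [abs_sub_comm, add_comm (Real.exp b)] at this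
    linarith
  have hD2 : |Real.exp a - Real.exp b| ≤ Real.exp a + Real.exp b := by
    rw [abs_le]
    constructor <;> linarith [Real.exp_pos a, Real.exp_pos b]
  have hD1' : (Real.exp a - Real.exp b) ^ 2 ≤ (a - b) ^ 2 * (Real.exp a + Real.exp b) ^ 2 := by
    rw [← sq_abs, ← sq_abs (a - b), ← mul_pow]
    gcongr
  have hD2' : (Real.exp a - Real.exp b) ^ 2 ≤ (Real.exp a + Real.exp b) ^ 2 := by
    rw [← sq_abs]
    gcongr
  set D := (Real.exp a - Real.exp b) ^ 2
  set S := (Real.exp a + Real.exp b) ^ 2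
  have hS0 : 0 ≤ S := sq_nonneg _
  have hD0 : 0 ≤ D := sq_nonneg _
  have hDS : D ≤ ((a - b) ^ 2) ^ (1 - ε) * S := by
    rcases le_or_gt 1 ((a - b) ^ 2) with h | h
    · have := Real.one_le_rpow h (by linarith : 0 ≤ 1 - ε)
      nlinarith
    · have : (a - b) ^ 2 ≤ ((a - b) ^ 2) ^ (1 - ε) := by
        rcases (sq_nonneg (a - b)).eq_or_lt with h0 | h0
        · rw [← h0, Real.zero_rpow (by linarith)]
        · calc (a - b) ^ 2 = ((a - b) ^ 2) ^ (1 : ℝ) := (Real.rpow_one _).symm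
            _ ≤ _ := Real.rpow_le_rpow_of_exponent_ge h0 h.le (by linarith)
      nlinarith
  have hdpow : d ^ (2 - 2 * ε) = (d ^ 2) ^ (1 - ε) := by
    rw [← Real.rpow_natCast, ← Real.rpow_mul hd]
    congr 1
    push_cast
    ring
  have hT : w * S = ((w * S) ^ (1 / ε)) ^ ε := by
    rw [← Real.rpow_mul (by positivity), one_div, inv_mul_cancel₀ hε.ne', Real.rpow_one]
  calc w * D / d ^ (2 - 2 * ε) ≤ w * (((a - b) ^ 2) ^ (1 - ε) * S) / (d ^ 2) ^ (1 - ε) := by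
        rw [hdpow]
        gcongr
    _ = ((a - b) ^ 2 / d ^ 2) ^ (1 - ε) * ((w * S) ^ (1 / ε)) ^ ε := by
        rw [← hT, Real.div_rpow (by positivity) (by positivity)]
        ring
    _ ≤ (1 - ε) * ((a - b) ^ 2 / d ^ 2) + ε * (w * S) ^ (1 / ε) :=
        Real.geom_mean_le_arith_mean2_weighted (by linarith) hε.le (by positivity)
          (by positivity) (by ring)
    _ ≤ (a - b) ^ 2 / d ^ 2 + (w * S) ^ (1 / ε) := by
        have h1 : 0 ≤ (a - b) ^ 2 / d ^ 2 := by positivity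
        have h2 : 0 ≤ (w * S) ^ (1 / ε) := by positivity
        nlinarith

/-- The Douglas energy density of a real function of the angle. -/
noncomputable def energyDensity (u : ℝ → ℝ) (x : ℝ) : ENNReal :=
  ∫⁻ y in Set.Ioc 0 (2 * π), ENNReal.ofReal ((u x - u y) ^ 2 / chord x y ^ 2)

lemma exists_Ioc_subset_near {x r : ℝ} (hx : x ∈ Set.Ioc 0 (2 * π)) (hr : r ≤ π) :
    ∃ a, Set.Ioo a (a + r) ⊆ Set.Ioc 0 (2 * π) ∧ ∀ y ∈ Set.Ioo a (a + r), y ≠ x ∧ |x - y| ≤ r := by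
  rcases le_or_gt x π with h | h
  · refine ⟨x, fun y hy => ⟨?_, ?_⟩, fun y hy => ⟨?_, ?_⟩⟩
    · linarith [hx.1, hy.1]
    · linarith [hy.2]
    · exact hy.1.ne'
    · rw [abs_le]; constructor <;> linarith [hy.1, hy.2]
  · refine ⟨x - r, fun y hy => ⟨?_, ?_⟩, fun y hy => ⟨?_, ?_⟩⟩
    · linarith [hy.1]
    · linarith [hy.2, hx.2]
    · exact ne_of_lt (by linarith [hy.2])
    · rw [abs_le]; constructor <;> linarith [hy.1, hy.2]

/-- Points of a superlevel set at height `k + 1` have large energy density when the superlevel set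
at height `k` is small. -/
lemma le_energyDensity {u : ℝ → ℝ} (hu : Measurable u) {k x m : ℝ}
    (hx : x ∈ Set.Ioc 0 (2 * π)) (hux : k + 1 < u x) (hm : 0 < m) (hmπ : m ≤ π / 2)
    (hA : volume ({y | k < u y} ∩ Set.Ioc 0 (2 * π)) = ENNReal.ofReal m) :
    ENNReal.ofReal (1 / (4 * m)) ≤ energyDensity u x := by
  obtain ⟨a, hsub, hnear⟩ := exists_Ioc_subset_near hx (by linarith : 2 * m ≤ π)
  set I := Set.Ioo a (a + 2 * m)
  set A := {y | k < u y}
  have hAm : MeasurableSet A := measurableSet_lt measurable_const hu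
  have hvol : ENNReal.ofReal m ≤ volume (I \ A) := by
    have h1 : volume I = ENNReal.ofReal m + ENNReal.ofReal m := by
      rw [Real.volume_Ioo, ← ENNReal.ofReal_add hm.le hm.le]; congr 1; ring
    have h2 : volume I ≤ volume (I \ A) + ENNReal.ofReal m := by
      rw [← hA, ← measure_sdiff_add_inter I hAm]
      have h3 : I ∩ A ⊆ A ∩ Set.Ioc 0 (2 * π) := fun y hy => ⟨hy.2, hsub hy.1⟩
      gcongr
    rw [h1] at h2
    exact (ENNReal.add_le_add_iff_right ENNReal.ofReal_ne_top).1 h2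
  calc ENNReal.ofReal (1 / (4 * m))
      = ENNReal.ofReal (1 / (2 * m) ^ 2) * ENNReal.ofReal m := by
        rw [← ENNReal.ofReal_mul (by positivity)]; congr 1; field_simp; ring
    _ ≤ ENNReal.ofReal (1 / (2 * m) ^ 2) * volume (I \ A) := by gcongr
    _ = ∫⁻ y in I \ A, ENNReal.ofReal (1 / (2 * m) ^ 2) := by rw [setLIntegral_const]
    _ ≤ ∫⁻ y in I \ A, ENNReal.ofReal ((u x - u y) ^ 2 / chord x y ^ 2) := by
        refine setLIntegral_mono' (measurableSet_Ioo.diff hAm) fun y hy => ?_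
        obtain ⟨hyx, hxy⟩ := hnear y hy.1
        have hy2 : u y ≤ k := not_lt.1 hy.2
        apply ENNReal.ofReal_le_ofReal
        have hc : 0 < chord x y := by
          refine (chord_nonneg x y).lt_of_ne' fun h0 => hyx ?_
          obtain ⟨j, hj⟩ := exists_int_eq_of_chord_eq_zero h0
          have hy3 := hsub hy.1
          have hπ := Real.pi_pos
          have h1 : (j : ℝ) < 1 := by by_contra! h; nlinarith [hx.1, hx.2, hy3.1, hy3.2]
          have h2 : (-1 : ℝ) < j := by by_contra! h; nlinarith [hx.1, hx.2, hy3.1, hy3.2]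
          have h3 : j = 0 := by
            have h1' : j < 1 := by exact_mod_cast h1
            have h2' : -1 < j := by exact_mod_cast h2
            omega
          rw [hj, h3]; simp
        have hcl := (chord_le_abs_sub x y).trans hxy
        apply div_le_div₀ (sq_nonneg _) _ (by positivity) (by gcongr)
        nlinarith
    _ ≤ energyDensity u x := lintegral_mono_set (Set.sdiff_subset.trans hsub)

lemma tendsto_volume_superlevel {u : ℝ → ℝ} (hu : Measurable u) :
    Filter.Tendsto (fun k : ℕ => volume ({y | (k : ℝ) < u y} ∩ Set.Ioc 0 (2 * π)))
      Filter.atTop (nhds 0) := by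
  have h := tendsto_measure_iInter_atTop (μ := volume)
    (s := fun k : ℕ => {y | (k : ℝ) < u y} ∩ Set.Ioc 0 (2 * π))
    (fun k => ((measurableSet_lt measurable_const hu).inter measurableSet_Ioc).nullMeasurableSet)
    (fun i j hij y hy => ⟨show (i : ℝ) < u y from (Nat.cast_le.2 hij).trans_lt hy.1, hy.2⟩)
    ⟨0, ((measure_mono Set.inter_subset_right).trans_lt measure_Ioc_lt_top).ne⟩
  have h0 : ⋂ k : ℕ, {y | (k : ℝ) < u y} ∩ Set.Ioc 0 (2 * π) = ∅ := by
    ext y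
    simp only [Set.mem_iInter, Set.mem_inter_iff, Set.mem_ofPred_eq, Set.mem_empty_iff_false,
      iff_false, not_forall]
    obtain ⟨n, hn⟩ := exists_nat_gt (u y)
    exact ⟨n, fun h => by linarith [h.1]⟩
  rwa [h0, measure_empty] at h

/-- A function of finite Douglas energy has superlevel sets of superexponentially decaying
measure. -/
lemma eventually_volume_superlevel_le {u : ℝ → ℝ} (hu : Measurable u)
    (hE : ∫⁻ x in Set.Ioc 0 (2 * π), energyDensity u x ≠ ⊤) {η : ℝ} (hη : 0 < η) :
    ∀ᶠ k : ℕ in Filter.atTop,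
      volume.real ({y | ((k + 1 : ℕ) : ℝ) < u y} ∩ Set.Ioc 0 (2 * π)) ≤
        η * volume.real ({y | (k : ℝ) < u y} ∩ Set.Ioc 0 (2 * π)) := by
  set A : ℕ → Set ℝ := fun k => {y | (k : ℝ) < u y} ∩ Set.Ioc 0 (2 * π) with hAdef
  have hAm : ∀ k, MeasurableSet (A k) := fun k =>
    (measurableSet_lt measurable_const hu).inter measurableSet_Ioc
  have hAfin : ∀ k, volume (A k) ≠ ⊤ := fun k =>
    ((measure_mono Set.inter_subset_right).trans_lt measure_Ioc_lt_top).ne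
  have hlim := tendsto_volume_superlevel hu
  have hν : Filter.Tendsto (fun k => ∫⁻ x in A (k + 1), energyDensity u x) Filter.atTop
      (nhds 0) := by
    have h := tendsto_setLIntegral_zero hE (l := Filter.atTop) (s := A) (by
      refine tendsto_of_tendsto_of_tendsto_of_le_of_le tendsto_const_nhds hlim
        (fun _ => zero_le) fun k => ?_
      exact Measure.restrict_apply_le _ _)
    have h2 : ∀ k, (volume.restrict (Set.Ioc 0 (2 * π))).restrict (A k) = volume.restrict (A k) :=
      fun k => by rw [Measure.restrict_restrict (hAm k), Set.inter_eq_left.2 Set.inter_subset_right]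
    simp only [h2] at h
    exact h.comp (Filter.tendsto_add_atTop_nat 1)
  have hπ := Real.pi_pos
  filter_upwards [hlim.eventually_le_const (ENNReal.ofReal_pos.2 (by positivity : 0 < π / 2)),
    hν.eventually_le_const (ENNReal.ofReal_pos.2 (by positivity : 0 < η / 4))] with k hk1 hk2
  change volume.real (A (k + 1)) ≤ η * volume.real (A k)
  have hmono : volume.real (A (k + 1)) ≤ volume.real (A k) :=
    measureReal_mono (fun y hy =>
      ⟨show (k : ℝ) < u y from (Nat.cast_le.2 k.le_succ).trans_lt hy.1, hy.2⟩) (hAfin k)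
  rcases (measureReal_nonneg (μ := volume) (s := A k)).eq_or_lt with h0 | h0
  · rw [← h0] at hmono ⊢
    linarith
  set m := volume.real (A k) with hmdef
  have hm : volume (A k) = ENNReal.ofReal m := (ofReal_measureReal (hAfin k)).symm
  have hmπ : m ≤ π / 2 := by
    change volume (A k) ≤ _ at hk1
    rw [hm] at hk1
    exact (ENNReal.ofReal_le_ofReal_iff (by positivity)).1 hk1
  have h3 : ENNReal.ofReal (1 / (4 * m)) * volume (A (k + 1)) ≤ ENNReal.ofReal (η / 4) := by
    refine le_trans ?_ hk2
    rw [← setLIntegral_const]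
    refine setLIntegral_mono' (hAm _) fun x hx => ?_
    refine le_energyDensity hu hx.2 (k := k) ?_ h0 hmπ hm
    have := hx.1
    simpa using this
  rw [← ofReal_measureReal (hAfin (k + 1)), ← ENNReal.ofReal_mul (by positivity),
    ENNReal.ofReal_le_ofReal_iff (by positivity)] at h3
  have : volume.real (A (k + 1)) = 4 * m * (1 / (4 * m) * volume.real (A (k + 1))) := by
    field_simp
  nlinarith

/-- A function on the circle of finite Douglas energy is exponentially integrable of positive
order. -/
lemma lintegral_exp_mul_lt_top_of_pos {u : ℝ → ℝ} (hu : Measurable u)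
    (hE : ∫⁻ x in Set.Ioc 0 (2 * π), energyDensity u x ≠ ⊤) {p : ℝ} (hp : 0 < p) :
    ∫⁻ x in Set.Ioc 0 (2 * π), ENNReal.ofReal (Real.exp (p * u x)) < ⊤ := by
  set A : ℕ → Set ℝ := fun k => {y | (k : ℝ) < u y} with hAdef
  have hAm : ∀ k, MeasurableSet (A k) := fun k => measurableSet_lt measurable_const hu
  have hAfin : ∀ k, volume (A k ∩ Set.Ioc 0 (2 * π)) ≠ ⊤ := fun k =>
    ((measure_mono Set.inter_subset_right).trans_lt measure_Ioc_lt_top).ne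
  have hsum : Summable fun k : ℕ =>
      Real.exp (p * (k + 1)) * volume.real (A k ∩ Set.Ioc 0 (2 * π)) := by
    refine summable_of_ratio_norm_eventually_le (r := 1 / 2) (by norm_num) ?_
    filter_upwards [eventually_volume_superlevel_le hu hE
      (by positivity : 0 < Real.exp (-p) / 2)] with k hk
    rw [Real.norm_of_nonneg (by positivity), Real.norm_of_nonneg (by positivity)]
    calc Real.exp (p * ((k + 1 : ℕ) + 1)) * volume.real (A (k + 1) ∩ Set.Ioc 0 (2 * π))
        ≤ Real.exp (p * ((k + 1 : ℕ) + 1)) *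
            (Real.exp (-p) / 2 * volume.real (A k ∩ Set.Ioc 0 (2 * π))) := by gcongr
      _ = 1 / 2 * (Real.exp (p * (k + 1)) * volume.real (A k ∩ Set.Ioc 0 (2 * π))) := by
        have : Real.exp (p * ((k + 1 : ℕ) + 1)) * Real.exp (-p) = Real.exp (p * (k + 1)) := by
          rw [← Real.exp_add]; congr 1; push_cast; ring
        rw [← this]; ring
  have hpt : ∀ x, ENNReal.ofReal (Real.exp (p * u x)) ≤
      1 + ∑' k : ℕ, (A k).indicator (fun _ => ENNReal.ofReal (Real.exp (p * (k + 1)))) x := by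
    intro x
    rcases le_or_gt (u x) 0 with h | h
    · refine le_trans ?_ le_self_add
      rw [ENNReal.ofReal_le_one, Real.exp_le_one_iff]
      exact mul_nonpos_of_nonneg_of_nonpos hp.le h
    · refine le_trans ?_ le_add_self
      have hc : 0 < ⌈u x⌉₊ := Nat.ceil_pos.2 h
      obtain ⟨n, hn⟩ : ∃ n, ⌈u x⌉₊ = n + 1 := ⟨_, (Nat.succ_pred_eq_of_pos hc).symm⟩
      have h1 : (n : ℝ) < u x := Nat.lt_ceil.1 (by omega)
      have h2 : u x ≤ n + 1 := by
        have := Nat.le_ceil (u x)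
        rw [hn] at this
        exact_mod_cast this
      refine le_trans ?_ (ENNReal.le_tsum n)
      rw [Set.indicator_of_mem (show x ∈ A n from h1)]
      apply ENNReal.ofReal_le_ofReal
      gcongr
  refine (lintegral_mono hpt).trans_lt ?_
  rw [lintegral_add_left measurable_const, lintegral_tsum fun k =>
    (measurable_const.indicator (hAm k)).aemeasurable]
  have hk : ∀ k : ℕ, ∫⁻ x in Set.Ioc 0 (2 * π),
      (A k).indicator (fun _ => ENNReal.ofReal (Real.exp (p * (k + 1)))) x =
      ENNReal.ofReal (Real.exp (p * (k + 1)) * volume.real (A k ∩ Set.Ioc 0 (2 * π))) := by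
    intro k
    rw [lintegral_indicator_const (hAm k), Measure.restrict_apply (hAm k),
      ENNReal.ofReal_mul (Real.exp_pos _).le, ofReal_measureReal (hAfin k)]
  simp_rw [hk]
  refine ENNReal.add_lt_top.2 ⟨by simp [ENNReal.mul_lt_top_iff], ?_⟩
  rw [← ENNReal.ofReal_tsum_of_nonneg (fun k => by positivity) hsum]
  exact ENNReal.ofReal_lt_top

/-- A function on the circle of finite Douglas energy is exponentially integrable of every order. -/
lemma lintegral_exp_mul_lt_top {u : ℝ → ℝ} (hu : Measurable u)
    (hE : ∫⁻ x in Set.Ioc 0 (2 * π), energyDensity u x ≠ ⊤) (p : ℝ) :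
    ∫⁻ x in Set.Ioc 0 (2 * π), ENNReal.ofReal (Real.exp (p * u x)) < ⊤ := by
  rcases lt_trichotomy p 0 with hp | rfl | hp
  · have h := lintegral_exp_mul_lt_top_of_pos (u := fun x => -u x) hu.neg (by
      have : energyDensity (fun x => -u x) = energyDensity u := by
        ext x
        simp only [energyDensity]
        refine lintegral_congr fun y => ?_
        congr 2
        ring
      rwa [this]) (neg_pos.2 hp)
    simpa using h
  · simp [ENNReal.mul_lt_top_iff]
  · exact lintegral_exp_mul_lt_top_of_pos hu hE hp

/-- A double integral dominated by the Douglas energy of `u` and exponentials of `u` is finite. -/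
lemma lintegral_lintegral_lt_top_of_le {u : ℝ → ℝ} (hu : Measurable u)
    (hE : ∫⁻ x in Set.Ioc 0 (2 * π), energyDensity u x ≠ ⊤) (F : ℝ → ℝ → ℝ) {B p q r s : ℝ}
    (hB : 0 ≤ B)
    (hF : ∀ x y, F x y ≤ (u x - u y) ^ 2 / chord x y ^ 2 +
      B * (Real.exp (p * u x) * Real.exp (q * u y) + Real.exp (r * u x) * Real.exp (s * u y))) :
    ∫⁻ x in Set.Ioc 0 (2 * π), ∫⁻ y in Set.Ioc 0 (2 * π), ENNReal.ofReal (F x y) < ⊤ := by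
  set e : ℝ → ℝ → ENNReal := fun p x => ENNReal.ofReal (Real.exp (p * u x)) with he
  have hem : ∀ p, Measurable (e p) := fun p => by fun_prop
  have hef : ∀ p, ∫⁻ x in Set.Ioc 0 (2 * π), e p x < ⊤ := lintegral_exp_mul_lt_top hu hE
  have hpt : ∀ x y, ENNReal.ofReal (F x y) ≤ ENNReal.ofReal ((u x - u y) ^ 2 / chord x y ^ 2) +
      ENNReal.ofReal B * (e p x * e q y + e r x * e s y) := by
    intro x y
    refine (ENNReal.ofReal_le_ofReal (hF x y)).trans (ENNReal.ofReal_add_le.trans ?_)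
    rw [ENNReal.ofReal_mul hB, ENNReal.ofReal_add (by positivity) (by positivity),
      ENNReal.ofReal_mul (Real.exp_pos _).le, ENNReal.ofReal_mul (Real.exp_pos _).le]
  have hinner : ∀ x, ∫⁻ y in Set.Ioc 0 (2 * π), ENNReal.ofReal (F x y) ≤ energyDensity u x +
      ENNReal.ofReal B * (e p x * (∫⁻ y in Set.Ioc 0 (2 * π), e q y) +
        e r x * (∫⁻ y in Set.Ioc 0 (2 * π), e s y)) := by
    intro x
    refine (lintegral_mono (hpt x)).trans_eq ?_
    have := hem q
    have := hem s
    rw [lintegral_add_right _ (by fun_prop), lintegral_const_mul _ (by fun_prop),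
      lintegral_add_right _ (by fun_prop), lintegral_const_mul _ (hem q),
      lintegral_const_mul _ (hem s), energyDensity]
  refine (lintegral_mono hinner).trans_lt ?_
  have := hem p
  have := hem r
  rw [lintegral_add_right _ (by fun_prop), lintegral_const_mul _ (by fun_prop),
    lintegral_add_right _ (by fun_prop), lintegral_mul_const _ (hem p),
    lintegral_mul_const _ (hem r)]
  exact ENNReal.add_lt_top.2 ⟨hE.lt_top, ENNReal.mul_lt_top ENNReal.ofReal_lt_top
    (ENNReal.add_lt_top.2 ⟨ENNReal.mul_lt_top (hef p) (hef q),
      ENNReal.mul_lt_top (hef r) (hef s)⟩)⟩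

/-- If `u` has finite Douglas energy then `exp u` has finite `Ḣ^{1/2-ε}` seminorm. -/
lemma sobolev_exp_lt_top {u : ℝ → ℝ} (hu : Measurable u)
    (hE : ∫⁻ x in Set.Ioc 0 (2 * π), energyDensity u x ≠ ⊤) {ε : ℝ} (hε : 0 < ε) (hε1 : ε < 1) :
    ∫⁻ x in Set.Ioc 0 (2 * π), ∫⁻ y in Set.Ioc 0 (2 * π),
      ENNReal.ofReal ((Real.exp (u x) - Real.exp (u y)) ^ 2 / chord x y ^ (2 - 2 * ε)) < ⊤ := by
  refine lintegral_lintegral_lt_top_of_le hu hE _ (B := 4 ^ (1 / ε)) (p := 2 * (1 / ε)) (q := 0)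
    (r := 0) (s := 2 * (1 / ε)) (by positivity) fun x y => ?_
  have h := weighted_exp_sub_sq_div_le hε hε1 (u x) (u y) (chord x y) 1 (chord_nonneg x y)
    zero_le_one
  rw [one_mul, one_mul] at h
  refine h.trans ?_
  gcongr
  simp only [zero_mul, Real.exp_zero, mul_one, one_mul]
  have key : ∀ a b : ℝ, b ≤ a → ((Real.exp a + Real.exp b) ^ 2) ^ (1 / ε) ≤
      4 ^ (1 / ε) * Real.exp (2 * (1 / ε) * a) := by
    intro a b hab
    have h1 : (Real.exp a + Real.exp b) ^ 2 ≤ 4 * Real.exp (2 * a) := by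
      have h2 : Real.exp (2 * a) = Real.exp a ^ 2 := by rw [← Real.exp_nat_mul]; simp
      have h3 := Real.exp_le_exp.2 hab
      rw [h2]
      nlinarith [Real.exp_pos a, Real.exp_pos b]
    calc _ ≤ (4 * Real.exp (2 * a)) ^ (1 / ε) := by gcongr
      _ = _ := by
        rw [Real.mul_rpow (by norm_num) (Real.exp_pos _).le, ← Real.exp_mul]
        congr 2
        ring
  rcases le_total (u y) (u x) with hxy | hxy
  · refine (key _ _ hxy).trans ?_
    gcongr
    linarith [Real.exp_pos (2 * (1 / ε) * u y)]
  · rw [add_comm]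
    refine (key _ _ hxy).trans ?_
    gcongr
    linarith [Real.exp_pos (2 * (1 / ε) * u x)]

/-- The weighted version of the Sobolev bound which controls the inverse homeomorphism. -/
lemma sobolev_exp_neg_lt_top {u : ℝ → ℝ} (hu : Measurable u)
    (hE : ∫⁻ x in Set.Ioc 0 (2 * π), energyDensity u x ≠ ⊤) {ε C : ℝ} (hε : 0 < ε) (hε1 : ε < 1)
    (hC : 0 ≤ C) :
    ∫⁻ x in Set.Ioc 0 (2 * π), ∫⁻ y in Set.Ioc 0 (2 * π),
      ENNReal.ofReal (C * Real.exp (u x + u y) *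
        (Real.exp (-u x) - Real.exp (-u y)) ^ 2 / chord x y ^ (2 - 2 * ε)) < ⊤ := by
  refine lintegral_lintegral_lt_top_of_le hu hE _ (B := (4 * C) ^ (1 / ε)) (p := 1 / ε)
    (q := -(1 / ε)) (r := -(1 / ε)) (s := 1 / ε) (by positivity) fun x y => ?_
  have h := weighted_exp_sub_sq_div_le hε hε1 (-u x) (-u y) (chord x y)
    (C * Real.exp (u x + u y)) (chord_nonneg x y) (by positivity)
  refine h.trans ?_
  rw [show (-u x - -u y) ^ 2 = (u x - u y) ^ 2 by ring]
  gcongr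
  have key : ∀ a b : ℝ, b ≤ a →
      (C * Real.exp (a + b) * (Real.exp (-a) + Real.exp (-b)) ^ 2) ^ (1 / ε) ≤
      (4 * C) ^ (1 / ε) * (Real.exp (1 / ε * a) * Real.exp (-(1 / ε) * b)) := by
    intro a b hab
    have h1 : C * Real.exp (a + b) * (Real.exp (-a) + Real.exp (-b)) ^ 2 ≤
        4 * C * Real.exp (a - b) := by
      have h2 : Real.exp (a - b) = Real.exp (a + b) * Real.exp (-b) ^ 2 := by
        rw [← Real.exp_nat_mul, ← Real.exp_add]
        congr 1
        push_cast
        ring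
      have h3 : (Real.exp (-a) + Real.exp (-b)) ^ 2 ≤ 4 * Real.exp (-b) ^ 2 := by
        have h4 := Real.exp_le_exp.2 (neg_le_neg hab)
        nlinarith [Real.exp_pos (-a), Real.exp_pos (-b)]
      rw [h2]
      calc _ ≤ C * Real.exp (a + b) * (4 * Real.exp (-b) ^ 2) := by gcongr
        _ = _ := by ring
    calc _ ≤ (4 * C * Real.exp (a - b)) ^ (1 / ε) := by gcongr
      _ = _ := by
        rw [Real.mul_rpow (by positivity) (Real.exp_pos _).le, ← Real.exp_mul, ← Real.exp_add]
        congr 2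
        ring
  rcases le_total (u y) (u x) with hxy | hxy
  · refine (key _ _ hxy).trans ?_
    gcongr
    exact le_add_of_nonneg_right (by positivity)
  · rw [add_comm (u x), add_comm (Real.exp (-u x))]
    refine (key _ _ hxy).trans ?_
    gcongr
    rw [mul_comm]
    exact le_add_of_nonneg_left (by positivity)

/-- Hölder continuity of the inverse of a homeomorphism with density `exp u`. -/
lemma exists_sub_le_mul_rpow {u H : ℝ → ℝ} (hu : Measurable u)
    (hup : Function.Periodic u (2 * π))
    (hexp : ∀ p : ℝ, ∫⁻ x in Set.Ioc 0 (2 * π), ENNReal.ofReal (Real.exp (p * u x)) < ⊤)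
    (hH : Monotone H)
    (hI : ∀ s t, s ≤ t →
      ∫⁻ x in Set.Ioc s t, ENNReal.ofReal (Real.exp (u x)) = ENNReal.ofReal (H t - H s))
    {α : ℝ} (hα : 0 < α) (hα1 : α < 1) :
    ∃ C : ℝ, 0 ≤ C ∧ ∀ x y, x ≤ y → y ≤ x + 2 * π → y - x ≤ C * (H y - H x) ^ α := by
  set β := -α / (1 - α)
  set M := ∫⁻ x in Set.Ioc 0 (2 * π), ENNReal.ofReal (Real.exp (β * u x)) with hM
  have h1α : 0 < 1 - α := by linarith
  have hMt : M ≠ ⊤ := (hexp β).ne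
  refine ⟨M.toReal ^ (1 - α), by positivity, fun x y hxy hy => ?_⟩
  have hpq : (1 / α).HolderConjugate (1 / (1 - α)) := by
    rw [Real.holderConjugate_iff]
    refine ⟨by rw [lt_div_iff₀ hα]; linarith, by simp⟩
  have hHol := ENNReal.lintegral_mul_le_Lp_mul_Lq (volume.restrict (Set.Ioc x y)) hpq
    (f := fun x => ENNReal.ofReal (Real.exp (α * u x)))
    (g := fun x => ENNReal.ofReal (Real.exp (-α * u x))) (by fun_prop) (by fun_prop)
  have e1 : ∀ z, ENNReal.ofReal (Real.exp (α * u z)) ^ (1 / α) =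
      ENNReal.ofReal (Real.exp (u z)) := by
    intro z
    rw [ENNReal.ofReal_rpow_of_pos (Real.exp_pos _), ← Real.exp_mul]
    congr 2
    field_simp
  have e2 : ∀ z, ENNReal.ofReal (Real.exp (-α * u z)) ^ (1 / (1 - α)) =
      ENNReal.ofReal (Real.exp (β * u z)) := by
    intro z
    rw [ENNReal.ofReal_rpow_of_pos (Real.exp_pos _), ← Real.exp_mul]
    congr 2
    ring
  have e3 : ∀ z, ((fun x => ENNReal.ofReal (Real.exp (α * u x))) *
      fun x => ENNReal.ofReal (Real.exp (-α * u x))) z = 1 := by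
    intro z
    rw [Pi.mul_apply, ← ENNReal.ofReal_mul (Real.exp_pos _).le, ← Real.exp_add]
    simp
  simp only [e1, e2, e3, one_div_one_div] at hHol
  rw [hI x y hxy, setLIntegral_one, Real.volume_Ioc] at hHol
  have hMle : ∫⁻ z in Set.Ioc x y, ENNReal.ofReal (Real.exp (β * u z)) ≤ M := by
    rw [hM, ← setLIntegral_Ioc_eq_of_periodic
      (f := fun z => ENNReal.ofReal (Real.exp (β * u z))) (fun z => by simp only [hup z]) x]
    exact lintegral_mono_set (Set.Ioc_subset_Ioc_right hy)
  have h2 : ENNReal.ofReal (y - x) ≤ ENNReal.ofReal (M.toReal ^ (1 - α) * (H y - H x) ^ α) := by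
    rw [ENNReal.ofReal_mul (by positivity), mul_comm,
      ← ENNReal.ofReal_rpow_of_nonneg (sub_nonneg.2 (hH hxy)) hα.le,
      ← ENNReal.ofReal_rpow_of_nonneg ENNReal.toReal_nonneg h1α.le, ENNReal.ofReal_toReal hMt]
    refine hHol.trans ?_
    gcongr
  have h3 : 0 ≤ H y - H x := sub_nonneg.2 (hH hxy)
  exact (ENNReal.ofReal_le_ofReal_iff (by positivity)).1 h2

lemma add_int_mul_two_pi {H : ℝ → ℝ} (hHp : ∀ θ, H (θ + 2 * π) = H θ + 2 * π) (x : ℝ) (k : ℤ) :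
    H (x + k * (2 * π)) = H x + k * (2 * π) := by
  have h : Function.Periodic (fun θ => H θ - θ) (2 * π) := fun θ => by
    simp only [hHp]
    ring
  have h2 : H (x + k * (2 * π)) - (x + k * (2 * π)) = H x - x := h.int_mul k x
  linarith

/-- Hölder continuity of the inverse homeomorphism in terms of chords. -/
lemma exists_chord_le_mul_rpow {u H : ℝ → ℝ} (hu : Measurable u)
    (hup : Function.Periodic u (2 * π))
    (hexp : ∀ p : ℝ, ∫⁻ x in Set.Ioc 0 (2 * π), ENNReal.ofReal (Real.exp (p * u x)) < ⊤)
    (hH : StrictMono H) (hHp : ∀ θ, H (θ + 2 * π) = H θ + 2 * π)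
    (hI : ∀ s t, s ≤ t →
      ∫⁻ x in Set.Ioc s t, ENNReal.ofReal (Real.exp (u x)) = ENNReal.ofReal (H t - H s))
    {α : ℝ} (hα : 0 < α) (hα1 : α < 1) :
    ∃ C : ℝ, 0 ≤ C ∧ ∀ x y, chord x y ≤ C * chord (H x) (H y) ^ α := by
  obtain ⟨C, hC, h⟩ := exists_sub_le_mul_rpow hu hup hexp hH.monotone hI hα hα1
  have hπ := Real.pi_pos
  refine ⟨C * (π / 2) ^ α, by positivity, fun x y => ?_⟩
  obtain ⟨k, hk1, hk2⟩ := exists_int_abs_sub_le_chord (H x) (H y)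
  rw [← add_int_mul_two_pi hHp] at hk1 hk2
  rw [← chord_add_int_mul x y k]
  set y' := y + k * (2 * π)
  rw [abs_le] at hk1
  have hxy : |x - y'| ≤ C * |H x - H y'| ^ α := by
    rcases le_total x y' with hle | hle
    · have h1 : y' ≤ x + 2 * π := by
        rw [← hH.le_iff_le, hHp]
        linarith
      rw [abs_sub_comm, abs_sub_comm (H x), abs_of_nonneg (sub_nonneg.2 hle),
        abs_of_nonneg (sub_nonneg.2 (hH.monotone hle))]
      exact h x y' hle h1
    · have h1 : x ≤ y' + 2 * π := by
        rw [← hH.le_iff_le, hHp]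
        linarith
      rw [abs_of_nonneg (sub_nonneg.2 hle), abs_of_nonneg (sub_nonneg.2 (hH.monotone hle))]
      exact h y' x hle h1
  calc chord x y' ≤ |x - y'| := chord_le_abs_sub _ _
    _ ≤ C * |H x - H y'| ^ α := hxy
    _ ≤ C * (π / 2 * chord (H x) (H y)) ^ α := by gcongr
    _ = C * (π / 2) ^ α * chord (H x) (H y) ^ α := by
      rw [Real.mul_rpow (by positivity) (chord_nonneg _ _)]
      ring

/-- Change of variables along a homeomorphism of the line with density `exp u`. -/
lemma setLIntegral_Ioc_comp {u H : ℝ → ℝ} (hu : Measurable u) (hHc : Continuous H)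
    (hH : StrictMono H) (hHs : Function.Surjective H)
    (hI : ∀ s t, s ≤ t →
      ∫⁻ x in Set.Ioc s t, ENNReal.ofReal (Real.exp (u x)) = ENNReal.ofReal (H t - H s))
    {F : ℝ → ENNReal} (hF : Measurable F) (a b : ℝ) :
    ∫⁻ s in Set.Ioc (H a) (H b), F s =
      ∫⁻ x in Set.Ioc a b, ENNReal.ofReal (Real.exp (u x)) * F (H x) := by
  have hpre : ∀ a b, H ⁻¹' Set.Ioc (H a) (H b) = Set.Ioc a b := fun a b => by
    ext x
    simp only [Set.mem_preimage, Set.mem_Ioc, hH.lt_iff_lt, hH.le_iff_le]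
  have hmap : (volume : Measure ℝ) =
      (volume.withDensity fun x => ENNReal.ofReal (Real.exp (u x))).map H := by
    refine Measure.ext_of_Ioc _ _ fun c d hcd => ?_
    obtain ⟨a, rfl⟩ := hHs c
    obtain ⟨b, rfl⟩ := hHs d
    rw [Measure.map_apply hHc.measurable measurableSet_Ioc, hpre,
      withDensity_apply _ measurableSet_Ioc, hI a b (hH.le_iff_le.1 hcd.le), Real.volume_Ioc]
  conv_lhs => rw [hmap]
  rw [setLIntegral_map measurableSet_Ioc hF hHc.measurable, hpre,
    setLIntegral_withDensity_eq_setLIntegral_mul _ (g := fun x => F (H x)) (by fun_prop)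
      (hF.comp hHc.measurable) measurableSet_Ioc]
  rfl

/-- Change of variables on the circle. -/
lemma setLIntegral_period_comp {u H : ℝ → ℝ} (hu : Measurable u) (hHc : Continuous H)
    (hH : StrictMono H) (hHs : Function.Surjective H) (hHp : ∀ θ, H (θ + 2 * π) = H θ + 2 * π)
    (hI : ∀ s t, s ≤ t →
      ∫⁻ x in Set.Ioc s t, ENNReal.ofReal (Real.exp (u x)) = ENNReal.ofReal (H t - H s))
    {F : ℝ → ENNReal} (hF : Measurable F) (hFp : Function.Periodic F (2 * π)) :
    ∫⁻ s in Set.Ioc 0 (2 * π), F s =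
      ∫⁻ x in Set.Ioc 0 (2 * π), ENNReal.ofReal (Real.exp (u x)) * F (H x) := by
  have h0 : H (2 * π) = H 0 + 2 * π := by simpa using hHp 0
  rw [← setLIntegral_Ioc_eq_of_periodic hFp (H 0), ← h0,
    setLIntegral_Ioc_comp hu hHc hH hHs hI hF]

lemma surjective_of_add_two_pi {H : ℝ → ℝ} (hHc : Continuous H)
    (hHp : ∀ θ, H (θ + 2 * π) = H θ + 2 * π) : Function.Surjective H := by
  intro y
  have hk := add_int_mul_two_pi hHp 0
  simp only [zero_add] at hk
  have hπ := Real.two_pi_pos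
  refine mem_range_of_exists_le_of_exists_ge hHc
    ⟨⌊(y - H 0) / (2 * π)⌋ * (2 * π), ?_⟩ ⟨⌈(y - H 0) / (2 * π)⌉ * (2 * π), ?_⟩
  · rw [hk]
    have := mul_le_mul_of_nonneg_right (Int.floor_le ((y - H 0) / (2 * π))) hπ.le
    rw [div_mul_cancel₀ _ hπ.ne'] at this
    linarith
  · rw [hk]
    have := mul_le_mul_of_nonneg_right (Int.le_ceil ((y - H 0) / (2 * π))) hπ.le
    rw [div_mul_cancel₀ _ hπ.ne'] at this
    linarith

lemma sobolevSeminorm_ofReal (s : ℝ) (f : ℝ → ℝ) :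
    sobolevSeminorm s (fun θ => (f θ : ℂ)) =
      ∫⁻ x in Set.Ioc 0 (2 * π), ∫⁻ y in Set.Ioc 0 (2 * π),
        ENNReal.ofReal ((f x - f y) ^ 2 / chord x y ^ (1 + 2 * s)) := by
  simp only [sobolevSeminorm, chord, ← Complex.ofReal_sub, Complex.norm_real, Real.norm_eq_abs,
    sq_abs]

lemma douglasEnergyP_ofReal (f : ℝ → ℝ) :
    douglasEnergyP (fun θ => (f θ : ℂ)) = ∫⁻ x in Set.Ioc 0 (2 * π), energyDensity f x := by
  simp only [douglasEnergyP, energyDensity, chord, ← Complex.ofReal_sub, Complex.norm_real,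
    Real.norm_eq_abs, sq_abs]

lemma douglasEnergyP_congr_ae {u v : ℝ → ℂ} (h : u =ᵐ[volume] v) :
    douglasEnergyP u = douglasEnergyP v := by
  refine lintegral_congr_ae (ae_restrict_of_ae ?_)
  filter_upwards [h] with x hx
  refine lintegral_congr_ae (ae_restrict_of_ae ?_)
  filter_upwards [h] with y hy
  rw [hx, hy]

lemma sobolevSeminorm_congr_ae (s : ℝ) {u v : ℝ → ℂ} (h : u =ᵐ[volume] v) :
    sobolevSeminorm s u = sobolevSeminorm s v := by
  refine lintegral_congr_ae (ae_restrict_of_ae ?_)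
  filter_upwards [h] with x hx
  refine lintegral_congr_ae (ae_restrict_of_ae ?_)
  filter_upwards [h] with y hy
  rw [hx, hy]

/-- The derivative of the inverse homeomorphism has finite `Ḣ^{1/2-ε}` seminorm. -/
lemma sobolevSeminorm_inverse_lt_top {u H K : ℝ → ℝ} (hu : Measurable u)
    (hup : Function.Periodic u (2 * π))
    (hE : ∫⁻ x in Set.Ioc 0 (2 * π), energyDensity u x ≠ ⊤)
    (hHc : Continuous H) (hH : StrictMono H) (hHp : ∀ θ, H (θ + 2 * π) = H θ + 2 * π)
    (hI : ∀ s t, s ≤ t →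
      ∫⁻ x in Set.Ioc s t, ENNReal.ofReal (Real.exp (u x)) = ENNReal.ofReal (H t - H s))
    (hKc : Continuous K) (hKH : ∀ θ, K (H θ) = θ) (hKp : ∀ θ, K (θ + 2 * π) = K θ + 2 * π)
    {ε : ℝ} (hε : 0 < ε) (hε1 : ε < 1 / 2) :
    sobolevSeminorm (1 / 2 - ε) (fun θ => ((Real.exp (-u (K θ)) : ℝ) : ℂ)) < ⊤ := by
  have hHs := surjective_of_add_two_pi hHc hHp
  have hexp := lintegral_exp_mul_lt_top hu hE
  have hψm : Measurable fun θ => Real.exp (-u (K θ)) := by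
    have := hu.comp hKc.measurable
    exact (this.neg).exp
  have hψp : ∀ θ, Real.exp (-u (K (θ + 2 * π))) = Real.exp (-u (K θ)) := fun θ => by
    rw [hKp, hup]
  have h2ε : 0 < 2 - ε := by linarith
  obtain ⟨C, hC, hch⟩ := exists_chord_le_mul_rpow hu hup hexp hH hHp hI
    (α := (2 - 2 * ε) / (2 - ε)) (div_pos (by linarith) h2ε) (by rw [div_lt_one h2ε]; linarith)
  have hker : ∀ x y, chord (H x) (H y) ≠ 0 → 1 / chord (H x) (H y) ^ (2 - 2 * ε) ≤
      C ^ (2 - ε) / chord x y ^ (2 - ε) := by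
    intro x y h0
    have hp : 0 < chord (H x) (H y) := (chord_nonneg _ _).lt_of_ne' h0
    have hp' : 0 < chord x y := by
      refine (chord_nonneg x y).lt_of_ne' fun h => h0 ?_
      obtain ⟨k, hk⟩ := exists_int_eq_of_chord_eq_zero h
      rw [hk, add_int_mul_two_pi hHp, chord_comm, chord_add_int_mul, chord_eq]
      simp
    rw [div_le_div_iff₀ (by positivity) (by positivity), one_mul]
    calc chord x y ^ (2 - ε) ≤ (C * chord (H x) (H y) ^ ((2 - 2 * ε) / (2 - ε))) ^ (2 - ε) := by
          gcongr
          exact hch x y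
      _ = C ^ (2 - ε) * chord (H x) (H y) ^ (2 - 2 * ε) := by
          rw [Real.mul_rpow hC (by positivity), ← Real.rpow_mul hp.le, div_mul_cancel₀ _ h2ε.ne']
  have hexpo : 1 + 2 * (1 / 2 - ε) = 2 - 2 * ε := by ring
  set G : ℝ → ℝ → ENNReal := fun s t => ENNReal.ofReal
    ((Real.exp (-u (K s)) - Real.exp (-u (K t))) ^ 2 / chord s t ^ (2 - 2 * ε)) with hG
  have hGm : Measurable (Function.uncurry G) := by
    have h1 : Measurable fun z : ℝ × ℝ => Real.exp (-u (K z.1)) := hψm.comp measurable_fst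
    have h2 : Measurable fun z : ℝ × ℝ => Real.exp (-u (K z.2)) := hψm.comp measurable_snd
    exact ((((h1.sub h2).pow_const 2).div (measurable_chord.pow_const _))).ennreal_ofReal
  have hinner : ∀ s, ∫⁻ t in Set.Ioc 0 (2 * π), G s t =
      ∫⁻ y in Set.Ioc 0 (2 * π), ENNReal.ofReal (Real.exp (u y)) * G s (H y) := fun s =>
    setLIntegral_period_comp (F := fun t => G s t) hu hHc hH hHs hHp hI
      hGm.of_uncurry_left
      (fun t => by simp only [hG, hψp, chord_add_two_pi_right])
  have houter : ∫⁻ s in Set.Ioc 0 (2 * π), ∫⁻ t in Set.Ioc 0 (2 * π), G s t =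
      ∫⁻ x in Set.Ioc 0 (2 * π), ENNReal.ofReal (Real.exp (u x)) *
        ∫⁻ t in Set.Ioc 0 (2 * π), G (H x) t :=
    setLIntegral_period_comp (F := fun s => ∫⁻ t in Set.Ioc 0 (2 * π), G s t) hu hHc hH hHs hHp hI
      hGm.lintegral_prod_right'
      (fun s => by simp only [hG, hψp, chord_add_two_pi_left])
  have hpt : ∀ x y, ENNReal.ofReal (Real.exp (u x)) *
      (ENNReal.ofReal (Real.exp (u y)) * G (H x) (H y)) ≤
      ENNReal.ofReal (C ^ (2 - ε) * Real.exp (u x + u y) *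
        (Real.exp (-u x) - Real.exp (-u y)) ^ 2 / chord x y ^ (2 - ε)) := by
    intro x y
    simp only [hG, hKH]
    rw [← ENNReal.ofReal_mul (Real.exp_pos _).le, ← ENNReal.ofReal_mul (Real.exp_pos _).le,
      ← mul_assoc, ← Real.exp_add]
    apply ENNReal.ofReal_le_ofReal
    set D := (Real.exp (-u x) - Real.exp (-u y)) ^ 2
    have hD : 0 ≤ D := sq_nonneg _
    by_cases h0 : chord (H x) (H y) = 0
    · rw [h0, Real.zero_rpow (by linarith), div_zero, mul_zero]
      have := chord_nonneg x y
      positivity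
    · calc Real.exp (u x + u y) * (D / chord (H x) (H y) ^ (2 - 2 * ε))
          = Real.exp (u x + u y) * D * (1 / chord (H x) (H y) ^ (2 - 2 * ε)) := by ring
        _ ≤ Real.exp (u x + u y) * D * (C ^ (2 - ε) / chord x y ^ (2 - ε)) :=
            mul_le_mul_of_nonneg_left (hker x y h0) (by positivity)
        _ = C ^ (2 - ε) * Real.exp (u x + u y) * D / chord x y ^ (2 - ε) := by ring
  have hfin := sobolev_exp_neg_lt_top hu hE (ε := ε / 2) (C := C ^ (2 - ε))
    (by linarith) (by linarith) (by positivity)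
  rw [show 2 - 2 * (ε / 2) = 2 - ε by ring] at hfin
  rw [sobolevSeminorm_ofReal, hexpo]
  calc ∫⁻ s in Set.Ioc 0 (2 * π), ∫⁻ t in Set.Ioc 0 (2 * π), G s t
      = ∫⁻ x in Set.Ioc 0 (2 * π), ∫⁻ y in Set.Ioc 0 (2 * π), ENNReal.ofReal (Real.exp (u x)) *
          (ENNReal.ofReal (Real.exp (u y)) * G (H x) (H y)) := by
        rw [houter]
        refine lintegral_congr fun x => ?_
        rw [hinner, lintegral_const_mul' _ _ ENNReal.ofReal_ne_top]
    _ ≤ _ := lintegral_mono fun x => lintegral_mono (hpt x)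
    _ < ⊤ := hfin

/-- The density of an absolutely continuous lift is locally integrable. -/
lemma locallyIntegrable_density {H φ : ℝ → ℝ} (hH : StrictMono H)
    (hFTC : ∀ s t : ℝ, s ≤ t → H t - H s = ∫ θ in s..t, φ θ) : LocallyIntegrable φ := by
  have hii : ∀ s t, s < t → IntervalIntegrable φ volume s t := by
    intro s t hst
    by_contra h
    have h1 := hFTC s t hst.le
    rw [intervalIntegral.integral_undef h] at h1
    linarith [hH hst]
  intro x
  refine ⟨Set.Ioc (x - 1) (x + 1), Ioc_mem_nhds (by linarith) (by linarith), ?_⟩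
  exact (intervalIntegrable_iff_integrableOn_Ioc_of_le (by linarith)).1 (hii _ _ (by linarith))

/-- The logarithm of the derivative of an absolutely continuous lift has an exactly periodic
measurable representative. -/
lemma exists_periodic_log_density {H φ : ℝ → ℝ} (hH : StrictMono H)
    (hHp : ∀ θ, H (θ + 2 * π) = H θ + 2 * π)
    (hFTC : ∀ s t : ℝ, s ≤ t → H t - H s = ∫ θ in s..t, φ θ) (hφpos : ∀ᵐ θ : ℝ, 0 < φ θ) :
    ∃ u : ℝ → ℝ, Measurable u ∧ Function.Periodic u (2 * π) ∧
      φ =ᵐ[volume] (fun θ => Real.exp (u θ)) ∧ (fun θ => Real.log (φ θ)) =ᵐ[volume] u := by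
  have hloc := locallyIntegrable_density hH hFTC
  have hderiv : ∀ᵐ θ : ℝ, deriv H θ = φ θ := by
    filter_upwards [LocallyIntegrable.ae_hasDerivAt_integral hloc] with x hx
    have h1 : HasDerivAt (fun t => H (x - 1) + ∫ θ in (x - 1)..t, φ θ) (φ x) x :=
      (hx (x - 1)).const_add _
    refine (h1.congr_of_eventuallyEq ?_).deriv
    filter_upwards [Ioi_mem_nhds (by linarith : x - 1 < x)] with t ht
    rw [← hFTC _ _ (le_of_lt ht)]
    ring
  refine ⟨fun θ => Real.log (deriv H θ), (measurable_deriv H).log, fun θ => ?_, ?_, ?_⟩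
  · have h : deriv (fun z => H (z + 2 * π)) θ = deriv H (θ + 2 * π) := deriv_comp_add_const ..
    simp only [hHp, deriv_add_const] at h
    simp only [h]
  · filter_upwards [hderiv, hφpos] with θ h1 h2
    rw [h1, Real.exp_log h2]
  · filter_upwards [hderiv] with θ h1
    rw [h1]

theorem wp_class_in_Hthreehalves_minus_epsilon
    -- the lift `H` of an orientation-preserving circle homeomorphism `h`
    (H : ℝ → ℝ) (hHc : Continuous H) (hHm : StrictMono H)
    (hHp : ∀ θ, H (θ + 2 * π) = H θ + 2 * π)
    -- `h` is absolutely continuous with derivative `φ = h' > 0` a.e. …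
    (φ : ℝ → ℝ) (hFTC : ∀ s t : ℝ, s ≤ t → H t - H s = ∫ θ in s..t, φ θ)
    (hφpos : ∀ᵐ θ : ℝ, 0 < φ θ)
    -- … and `E(log h') < ∞`: `h` is of Weil–Petersson class
    (hE : douglasEnergyP (fun θ => (Real.log (φ θ) : ℂ)) < ⊤) :
    ∀ ε : ℝ, 0 < ε → ε < 1 / 2 →
      -- `h ∈ H^{3/2−ε}(S¹)` : `h' ∈ L²(0,2π)` and `h'` has finite `Ḣ^{1/2−ε}` seminorm
      ((∫⁻ θ in Set.Ioc 0 (2 * π), ENNReal.ofReal (φ θ ^ 2)) < ⊤ ∧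
        sobolevSeminorm (1 / 2 - ε) (fun θ => (φ θ : ℂ)) < ⊤) ∧
      -- `h⁻¹ ∈ H^{3/2−ε}(S¹)` : `h⁻¹` is absolutely continuous, with derivative in
      -- `L²(0,2π)` and of finite `Ḣ^{1/2−ε}` seminorm
      (∃ K : ℝ → ℝ, (∀ θ, K (H θ) = θ) ∧ (∀ θ, H (K θ) = θ) ∧
        ∃ ψ : ℝ → ℝ,
          (∀ s t : ℝ, s ≤ t → K t - K s = ∫ θ in s..t, ψ θ) ∧
          (∫⁻ θ in Set.Ioc 0 (2 * π), ENNReal.ofReal (ψ θ ^ 2)) < ⊤ ∧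
          sobolevSeminorm (1 / 2 - ε) (fun θ => (ψ θ : ℂ)) < ⊤) := by
  intro ε hε hε1
  obtain ⟨u, hu, hup, hφu, hlog⟩ := exists_periodic_log_density hHm hHp hFTC hφpos
  have hE' : ∫⁻ x in Set.Ioc 0 (2 * π), energyDensity u x ≠ ⊤ := by
    rw [← douglasEnergyP_ofReal, ← douglasEnergyP_congr_ae
      (u := fun θ => (Real.log (φ θ) : ℂ)) (by filter_upwards [hlog] with θ h; rw [h])]
    exact hE.ne
  have hexp := lintegral_exp_mul_lt_top hu hE'
  have hI : ∀ s t, s ≤ t →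
      ∫⁻ x in Set.Ioc s t, ENNReal.ofReal (Real.exp (u x)) = ENNReal.ofReal (H t - H s) := by
    intro s t hst
    rw [hFTC s t hst, intervalIntegral.integral_of_le hst, ofReal_integral_eq_lintegral_ofReal]
    · refine lintegral_congr_ae (ae_restrict_of_ae ?_)
      filter_upwards [hφu] with x hx
      rw [hx]
    · exact ((locallyIntegrable_density hHm hFTC).integrableOn_isCompact isCompact_Icc).mono_set
        Set.Ioc_subset_Icc_self
    · exact ae_restrict_of_ae (hφpos.mono fun x hx => hx.le)
  refine ⟨⟨?_, ?_⟩, ?_⟩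
  · have h : ∫⁻ θ in Set.Ioc 0 (2 * π), ENNReal.ofReal (φ θ ^ 2) =
        ∫⁻ θ in Set.Ioc 0 (2 * π), ENNReal.ofReal (Real.exp (2 * u θ)) := by
      refine lintegral_congr_ae (ae_restrict_of_ae ?_)
      filter_upwards [hφu] with x hx
      rw [hx, ← Real.exp_nat_mul]
      simp
    rw [h]
    exact hexp 2
  · rw [sobolevSeminorm_congr_ae _ (v := fun θ => ((Real.exp (u θ) : ℝ) : ℂ))
      (by filter_upwards [hφu] with θ h; rw [h]), sobolevSeminorm_ofReal,
      show 1 + 2 * (1 / 2 - ε) = 2 - 2 * ε by ring]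
    exact sobolev_exp_lt_top hu hE' hε (by linarith)
  have hHs := surjective_of_add_two_pi hHc hHp
  set e := hHm.orderIsoOfSurjective H hHs with he
  have hKc : Continuous e.symm := e.symm.continuous
  have hKH : ∀ θ, e.symm (H θ) = θ := fun θ => e.symm_apply_apply θ
  have hHK : ∀ θ, H (e.symm θ) = θ := fun θ => e.apply_symm_apply θ
  have hKp : ∀ θ, e.symm (θ + 2 * π) = e.symm θ + 2 * π := fun θ =>
    hHm.injective (by rw [hHK, hHp, hHK])
  have hψm : Measurable fun θ => Real.exp (-u (e.symm θ)) :=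
    (hu.comp hKc.measurable).neg.exp
  refine ⟨e.symm, hKH, hHK, fun θ => Real.exp (-u (e.symm θ)), fun s t hst => ?_, ?_,
    sobolevSeminorm_inverse_lt_top hu hup hE' hHc hHm hHp hI hKc hKH hKp hε hε1⟩
  · rw [intervalIntegral.integral_of_le hst,
      integral_eq_lintegral_of_nonneg_ae (Filter.Eventually.of_forall fun _ => (Real.exp_pos _).le)
      hψm.aestronglyMeasurable]
    have hst' : e.symm s ≤ e.symm t := e.symm.monotone hst
    have h := setLIntegral_Ioc_comp hu hHc hHm hHs hI hψm.ennreal_ofReal (e.symm s) (e.symm t)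
    rw [hHK, hHK] at h
    rw [h]
    simp only [hKH]
    simp only [← ENNReal.ofReal_mul (Real.exp_pos _).le, ← Real.exp_add, add_neg_cancel,
      Real.exp_zero, ENNReal.ofReal_one, setLIntegral_one, Real.volume_Ioc]
    rw [ENNReal.toReal_ofReal (sub_nonneg.2 hst')]
  · rw [setLIntegral_period_comp hu hHc hHm hHs hHp hI (hψm.pow_const 2).ennreal_ofReal
      fun θ => by simp only [hKp, hup (e.symm θ)]]
    refine lt_of_eq_of_lt (lintegral_congr fun x => ?_) (hexp (-1))
    rw [hKH, ← ENNReal.ofReal_mul (Real.exp_pos _).le, ← Real.exp_nat_mul, ← Real.exp_add]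
    congr 2
    push_cast
    ring
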